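/- arXiv:2306.15452 — 4 statements merged into one kernel-verified Lean document; each statement's English description precedes it below -/
import Mathlib

section
/- There exist a constant M ≥ 2 and a constant c_M > 0, depending only on N, s, λ, Λ, such that for every admissible kernel K and every x ∈ B₁ (the open unit ball of ℝ^N), the integral defining L_K φ_M(x) converges absolutely and L_K φ_M(x) ≤ −c_M, where φ_M(x) = max(M² − |x|², 0). -/
open MeasureTheory

/-- The barrier function `φ_M(x) = max(M² − |x|², 0)`. -/
noncomputable def phiM (N : ℕ) (M : ℝ) (x : EuclideanSpace ℝ (Fin N)) : ℝ :=
  max (M ^ 2 - ‖x‖ ^ 2) 0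

/-- A kernel is admissible if it is measurable, symmetric, and comparable to
`|z|^{-(N+2s)}` with ellipticity constants `lam ≤ Lam`. -/
def IsAdmissibleKernel (N : ℕ) (s lam Lam : ℝ)
    (K : EuclideanSpace ℝ (Fin N) → ℝ) : Prop :=
  Measurable K ∧ (∀ z : EuclideanSpace ℝ (Fin N), z ≠ 0 → K (-z) = K z) ∧
    ∀ z : EuclideanSpace ℝ (Fin N), z ≠ 0 →
      lam * ‖z‖ ^ (-((N : ℝ) + 2 * s)) ≤ K z ∧
        K z ≤ Lam * ‖z‖ ^ (-((N : ℝ) + 2 * s))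

/-- `|z|^{2-p}` is integrable near the origin for `p = N + 2s`, `s < 1`. -/
lemma integrableOn_ball_sq_mul_norm_rpow {N : ℕ} (hN : 1 ≤ N) {s : ℝ} (hs : s < 1) :
    IntegrableOn (fun z : EuclideanSpace ℝ (Fin N) => ‖z‖ ^ 2 * ‖z‖ ^ (-((N : ℝ) + 2 * s)))
      (Metric.ball 0 1) := by
  have : Nonempty (Fin N) := ⟨⟨0, hN⟩⟩
  refine (integrableOn_fun_norm_addHaar volume
    (f := fun y : ℝ => y ^ 2 * y ^ (-((N : ℝ) + 2 * s)))).2 ?_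
  have h : IntegrableOn (fun y : ℝ => y ^ (1 - 2 * s)) (Set.Ioo 0 1) :=
    (intervalIntegral.integrableOn_Ioo_rpow_iff one_pos).2 (by linarith)
  refine h.congr_fun (fun y hy => ?_) measurableSet_Ioo
  simp only [finrank_euclideanSpace, Fintype.card_fin, smul_eq_mul]
  rw [← Real.rpow_natCast y (N - 1), ← Real.rpow_natCast y 2, ← Real.rpow_add hy.1,
    ← Real.rpow_add hy.1, Nat.cast_sub hN]
  congr 1
  push_cast
  ring

/-- `|z|^{-p}` is integrable away from the origin for `p = N + 2s`, `s > 0`. -/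
lemma integrableOn_compl_ball_norm_rpow (N : ℕ) {s : ℝ} (hs : 0 < s) :
    IntegrableOn (fun z : EuclideanSpace ℝ (Fin N) => ‖z‖ ^ (-((N : ℝ) + 2 * s)))
      (Metric.ball 0 1)ᶜ := by
  have hp : 0 < (N : ℝ) + 2 * s := by positivity
  have h : Integrable (fun z : EuclideanSpace ℝ (Fin N) => (1 + ‖z‖) ^ (-((N : ℝ) + 2 * s))) :=
    integrable_one_add_norm (by simpa using hs)
  refine Integrable.mono' (h.integrableOn.const_mul (2 ^ ((N : ℝ) + 2 * s)))
    (Measurable.aestronglyMeasurable (by fun_prop)) (ae_restrict_of_forall_mem measurableSet_ball.compl fun z hz => ?_)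
  have hz : 1 ≤ ‖z‖ := by simpa using hz
  rw [Real.norm_of_nonneg (by positivity)]
  calc ‖z‖ ^ (-((N : ℝ) + 2 * s)) = 2 ^ ((N : ℝ) + 2 * s) * (2 * ‖z‖) ^ (-((N : ℝ) + 2 * s)) := by
        rw [Real.mul_rpow (by norm_num) (by positivity), ← mul_assoc, ← Real.rpow_add (by norm_num)]
        simp
    _ ≤ _ := by
        gcongr ?_ * ?_
        exact Real.rpow_le_rpow_of_nonpos (by positivity) (by linarith) (by linarith)

/-- The mass of `|z|^{-p}` outside a large ball tends to zero. -/
lemma tendsto_setIntegral_compl_ball_norm_rpow (N : ℕ) {s : ℝ} (hs : 0 < s) :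
    Filter.Tendsto (fun n : ℕ => ∫ z in (Metric.ball (0 : EuclideanSpace ℝ (Fin N)) (n + 1))ᶜ,
      ‖z‖ ^ (-((N : ℝ) + 2 * s))) Filter.atTop (nhds 0) := by
  have h := tendsto_setIntegral_of_antitone (μ := volume)
    (f := fun z : EuclideanSpace ℝ (Fin N) => ‖z‖ ^ (-((N : ℝ) + 2 * s)))
    (s := fun n : ℕ => (Metric.ball (0 : EuclideanSpace ℝ (Fin N)) (n + 1))ᶜ)
    (fun n => measurableSet_ball.compl)
    (fun m n hmn => Set.compl_subset_compl.2 (Metric.ball_subset_ball (by gcongr)))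
    ⟨0, by simpa using integrableOn_compl_ball_norm_rpow N hs⟩
  have he : ⋂ n : ℕ, (Metric.ball (0 : EuclideanSpace ℝ (Fin N)) (n + 1))ᶜ = ∅ := by
    refine Set.eq_empty_of_forall_notMem fun z hz => ?_
    obtain ⟨n, hn⟩ := exists_nat_gt ‖z‖
    have := Set.mem_iInter.1 hz n
    simp only [Set.mem_compl_iff, Metric.mem_ball, dist_zero_right, not_lt] at this
    linarith
  simpa [he] using h

lemma setIntegral_ball_sq_mul_norm_rpow_pos {N : ℕ} (hN : 1 ≤ N) {s : ℝ} (hs : s < 1) :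
    0 < ∫ z in Metric.ball (0 : EuclideanSpace ℝ (Fin N)) 1,
      ‖z‖ ^ 2 * ‖z‖ ^ (-((N : ℝ) + 2 * s)) := by
  have : Nonempty (Fin N) := ⟨⟨0, hN⟩⟩
  rw [setIntegral_pos_iff_support_of_nonneg_ae (.of_forall fun z => by positivity)
    (integrableOn_ball_sq_mul_norm_rpow hN hs)]
  have hsub : Metric.ball (0 : EuclideanSpace ℝ (Fin N)) 1 \ {0} ⊆
      Function.support (fun z : EuclideanSpace ℝ (Fin N) =>
        ‖z‖ ^ 2 * ‖z‖ ^ (-((N : ℝ) + 2 * s))) ∩ Metric.ball 0 1 := by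
    rintro z ⟨hz, hz0⟩
    have : 0 < ‖z‖ := norm_pos_iff.2 hz0
    exact ⟨(by positivity : (0 : ℝ) < ‖z‖ ^ 2 * ‖z‖ ^ (-((N : ℝ) + 2 * s))).ne', hz⟩
  refine lt_of_lt_of_le ?_ (measure_mono hsub)
  rw [measure_sdiff_null (measure_singleton _)]
  exact Metric.measure_ball_pos _ _ one_pos

section SecondDifference

variable {N : ℕ} {M : ℝ} {x z : EuclideanSpace ℝ (Fin N)}

lemma continuous_phiM (N : ℕ) (M : ℝ) : Continuous (phiM N M) := by
  unfold phiM
  fun_prop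

lemma phiM_nonneg (y : EuclideanSpace ℝ (Fin N)) : 0 ≤ phiM N M y := le_max_right _ _

lemma phiM_le_sq (y : EuclideanSpace ℝ (Fin N)) : phiM N M y ≤ M ^ 2 :=
  max_le (by nlinarith [sq_nonneg ‖y‖]) (sq_nonneg M)

lemma phiM_of_norm_le {y : EuclideanSpace ℝ (Fin N)} (hy : ‖y‖ ≤ M) :
    phiM N M y = M ^ 2 - ‖y‖ ^ 2 :=
  max_eq_left (by nlinarith [norm_nonneg y])

/-- Inside the region where the barrier is a paraboloid, its second difference is `-2|z|²`. -/
lemma phiM_second_difference_eq (h : ‖x‖ + ‖z‖ ≤ M) :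
    phiM N M (x + z) + phiM N M (x - z) - 2 * phiM N M x = -2 * ‖z‖ ^ 2 := by
  rw [phiM_of_norm_le ((norm_add_le _ _).trans h), phiM_of_norm_le ((norm_sub_le _ _).trans h),
    phiM_of_norm_le (by linarith [norm_nonneg z])]
  linarith [parallelogram_law_with_norm ℝ x z]

lemma phiM_second_difference_le_two (hM : 2 ≤ M) (hx : ‖x‖ < 1) :
    phiM N M (x + z) + phiM N M (x - z) - 2 * phiM N M x ≤ 2 := by
  have h := phiM_of_norm_le (y := x) (M := M) (by linarith)
  nlinarith [phiM_le_sq (M := M) (x + z), phiM_le_sq (M := M) (x - z), norm_nonneg x]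

lemma abs_phiM_second_difference_le :
    |phiM N M (x + z) + phiM N M (x - z) - 2 * phiM N M x| ≤ 2 * M ^ 2 := by
  rw [abs_le]
  constructor <;>
  linarith [phiM_le_sq (M := M) (x + z), phiM_le_sq (M := M) (x - z), phiM_le_sq (M := M) x,
    phiM_nonneg (M := M) (x + z), phiM_nonneg (M := M) (x - z), phiM_nonneg (M := M) x]

variable {s lam Lam : ℝ} {K : EuclideanSpace ℝ (Fin N) → ℝ}

lemma integrable_phiM_second_difference_mul (hN : 1 ≤ N) (hs : s ∈ Set.Ioo (0 : ℝ) 1)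
    (hlam : 0 ≤ lam) (hK : IsAdmissibleKernel N s lam Lam K)
    (hM : 2 ≤ M) (hx : ‖x‖ < 1) :
    Integrable (fun z => (phiM N M (x + z) + phiM N M (x - z) - 2 * phiM N M x) * K z) := by
  obtain ⟨hKm, -, hKb⟩ := hK
  have hc := continuous_phiM N M
  have hmeas : AEStronglyMeasurable
      (fun z => (phiM N M (x + z) + phiM N M (x - z) - 2 * phiM N M x) * K z) volume :=
    (Continuous.aestronglyMeasurable (by fun_prop)).mul hKm.aestronglyMeasurable
  have hnorm : ∀ z ≠ 0, |K z| ≤ Lam * ‖z‖ ^ (-((N : ℝ) + 2 * s)) := fun z hz => by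
    rw [abs_of_nonneg (le_trans (by positivity) (hKb z hz).1)]
    exact (hKb z hz).2
  rw [← integrableOn_univ, ← Set.union_compl_self (Metric.ball 0 1)]
  refine IntegrableOn.union ?_ ?_
  · refine Integrable.mono' ((integrableOn_ball_sq_mul_norm_rpow hN hs.2).const_mul (2 * Lam))
      hmeas.restrict (ae_restrict_of_forall_mem measurableSet_ball fun z hz => ?_)
    have hz : ‖z‖ < 1 := by simpa using hz
    rw [phiM_second_difference_eq (by linarith)]
    rcases eq_or_ne z 0 with rfl | hz0
    · simp
    · calc ‖-2 * ‖z‖ ^ 2 * K z‖ = 2 * ‖z‖ ^ 2 * |K z| := by simp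
        _ ≤ 2 * ‖z‖ ^ 2 * (Lam * ‖z‖ ^ (-((N : ℝ) + 2 * s))) := by gcongr; exact hnorm z hz0
        _ = _ := by ring
  · refine Integrable.mono' ((integrableOn_compl_ball_norm_rpow N hs.1).const_mul (2 * M ^ 2 * Lam))
      hmeas.restrict (ae_restrict_of_forall_mem measurableSet_ball.compl fun z hz => ?_)
    have hz : 1 ≤ ‖z‖ := by simpa using hz
    rw [norm_mul, Real.norm_eq_abs, Real.norm_eq_abs, mul_assoc (2 * M ^ 2)]
    gcongr
    · exact abs_phiM_second_difference_le
    · exact hnorm z (norm_pos_iff.1 (by linarith))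

/-- The near part of the second difference is strictly negative, the far part is controlled by
the tail of the kernel. -/
lemma integral_phiM_second_difference_mul_le (hN : 1 ≤ N) (hs : s ∈ Set.Ioo (0 : ℝ) 1)
    (hlam : 0 ≤ lam) (hK : IsAdmissibleKernel N s lam Lam K)
    (hM : 2 ≤ M) (hx : ‖x‖ < 1) :
    ∫ z, (phiM N M (x + z) + phiM N M (x - z) - 2 * phiM N M x) * K z ≤
      -(2 * lam) * (∫ z in Metric.ball (0 : EuclideanSpace ℝ (Fin N)) 1,
        ‖z‖ ^ 2 * ‖z‖ ^ (-((N : ℝ) + 2 * s))) +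
      2 * Lam * ∫ z in (Metric.ball (0 : EuclideanSpace ℝ (Fin N)) (M - 1))ᶜ,
        ‖z‖ ^ (-((N : ℝ) + 2 * s)) := by
  have hint := integrable_phiM_second_difference_mul hN hs hlam hK hM hx
  obtain ⟨-, -, hKb⟩ := hK
  have hi₁ := (integrableOn_ball_sq_mul_norm_rpow hN hs.2).integrable_indicator measurableSet_ball
  have hi₂ := ((integrableOn_compl_ball_norm_rpow N hs.1).mono_set
    (Set.compl_subset_compl.2 (Metric.ball_subset_ball (by linarith : 1 ≤ M - 1))))
    |>.integrable_indicator measurableSet_ball.compl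
  rw [← integral_indicator measurableSet_ball, ← integral_indicator measurableSet_ball.compl,
    ← integral_const_mul, ← integral_const_mul,
    ← integral_add (hi₁.const_mul _) (hi₂.const_mul _)]
  refine integral_mono hint ((hi₁.const_mul _).add (hi₂.const_mul _)) fun z => ?_
  rcases lt_or_ge ‖z‖ (M - 1) with hzM | hzM
  · have hz2 : z ∉ (Metric.ball (0 : EuclideanSpace ℝ (Fin N)) (M - 1))ᶜ :=
      Set.notMem_compl_iff.2 (mem_ball_zero_iff.2 hzM)
    rw [phiM_second_difference_eq (by linarith), Set.indicator_of_notMem hz2]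
    rcases eq_or_ne z 0 with rfl | hz0
    · simp
    have hl := (hKb z hz0).1
    have hK0 : 0 ≤ K z := le_trans (by positivity) hl
    by_cases hz1 : z ∈ Metric.ball (0 : EuclideanSpace ℝ (Fin N)) 1
    · rw [Set.indicator_of_mem hz1]
      nlinarith [mul_le_mul_of_nonneg_left hl (sq_nonneg ‖z‖)]
    · rw [Set.indicator_of_notMem hz1]
      nlinarith [mul_nonneg (sq_nonneg ‖z‖) hK0]
  · obtain ⟨hl, hu⟩ := hKb z (norm_pos_iff.1 (by linarith))
    have hK0 : 0 ≤ K z := le_trans (by positivity) hl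
    have hz1 : 1 ≤ ‖z‖ := by linarith
    rw [Set.indicator_of_notMem (by simpa using hz1), Set.indicator_of_mem (by simpa using hzM)]
    nlinarith [mul_le_mul_of_nonneg_right (phiM_second_difference_le_two (z := z) hM hx) hK0]

end SecondDifference

theorem stmt0 (N : ℕ) (hN : 1 ≤ N) (s lam Lam : ℝ) (hs : s ∈ Set.Ioo (0 : ℝ) 1)
    (hlam : 0 < lam) (hLam : lam ≤ Lam) :
    ∃ M : ℝ, 2 ≤ M ∧ ∃ c : ℝ, 0 < c ∧
      ∀ K : EuclideanSpace ℝ (Fin N) → ℝ, IsAdmissibleKernel N s lam Lam K →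
        ∀ x : EuclideanSpace ℝ (Fin N), ‖x‖ < 1 →
          Integrable (fun z => (phiM N M (x + z) + phiM N M (x - z) - 2 * phiM N M x) * K z) ∧
          (1 / 2) * ∫ z, (phiM N M (x + z) + phiM N M (x - z) - 2 * phiM N M x) * K z ≤ -c := by
  set A := ∫ z in Metric.ball (0 : EuclideanSpace ℝ (Fin N)) 1,
    ‖z‖ ^ 2 * ‖z‖ ^ (-((N : ℝ) + 2 * s)) with hA
  have hApos : 0 < A := setIntegral_ball_sq_mul_norm_rpow_pos hN hs.2
  have hLpos : 0 < Lam := hlam.trans_le hLam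
  obtain ⟨n, hn⟩ := ((tendsto_setIntegral_compl_ball_norm_rpow N hs.1).eventually_lt_const
    (show 0 < lam * A / (2 * Lam) by positivity)).exists
  have hM : (2 : ℝ) ≤ n + 2 := by linarith [n.cast_nonneg (α := ℝ)]
  refine ⟨n + 2, hM, lam * A / 2, by positivity, fun K hK x hx =>
    ⟨integrable_phiM_second_difference_mul hN hs hlam.le hK hM hx, ?_⟩⟩
  have h := integral_phiM_second_difference_mul_le hN hs hlam.le hK hM hx
  rw [← hA, show (n : ℝ) + 2 - 1 = n + 1 by ring] at h
  rw [lt_div_iff₀ (by positivity)] at hn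
  linarith
end

section
/- Let s ∈ (0,1) and σ ∈ (0, 2s). There exists a constant C > 0, depending only on N, s and σ, such that for every R > 2 and every x ∈ ℝ^N with |x| < 1, one has 0 ≤ ∫_{ℝ^N \ B_R} (|y|^σ − R^σ) |x − y|^{−(N+2s)} dy ≤ C R^{σ − 2s}. -/
open MeasureTheory

theorem integrableOn_norm_rpow_compl_ball {E : Type*} [NormedAddCommGroup E] [NormedSpace ℝ E]
    [FiniteDimensional ℝ E] [MeasurableSpace E] [BorelSpace E] (μ : Measure E)
    [μ.IsAddHaarMeasure] {r : ℝ} (hr : (Module.finrank ℝ E : ℝ) < r) :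
    IntegrableOn (fun y : E => ‖y‖ ^ (-r)) (Metric.ball (0 : E) 1)ᶜ μ := by
  have hr0 : 0 < r := (Nat.cast_nonneg _).trans_lt hr
  refine (((integrable_one_add_norm (μ := μ) hr).const_mul (2 ^ r)).integrableOn
    (s := (Metric.ball (0 : E) 1)ᶜ)).mono' ?_ ?_
  · exact (measurable_norm.pow_const (-r)).aestronglyMeasurable
  · refine (ae_restrict_mem Metric.isOpen_ball.measurableSet.compl).mono fun y hy => ?_
    have hy1 : 1 ≤ ‖y‖ := by simpa using hy
    rw [Real.norm_of_nonneg (by positivity)]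
    have h2 : (2 : ℝ) ^ r = 2⁻¹ ^ (-r) := by
      rw [Real.inv_rpow (by norm_num), Real.rpow_neg (by norm_num), inv_inv]
    rw [h2, ← Real.mul_rpow (by norm_num) (by positivity)]
    exact Real.rpow_le_rpow_of_nonpos (by positivity) (by linarith) (by linarith)

theorem setIntegral_norm_rpow_compl_ball {E : Type*} [NormedAddCommGroup E] [NormedSpace ℝ E]
    [FiniteDimensional ℝ E] [MeasurableSpace E] [BorelSpace E] (μ : Measure E)
    [μ.IsAddHaarMeasure] (q : ℝ) {R : ℝ} (hR : 0 < R) :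
    ∫ y in (Metric.ball (0 : E) R)ᶜ, ‖y‖ ^ q ∂μ =
      R ^ ((Module.finrank ℝ E : ℝ) + q) * ∫ y in (Metric.ball (0 : E) 1)ᶜ, ‖y‖ ^ q ∂μ := by
  have h := Measure.setIntegral_comp_smul_of_pos μ (fun y : E => ‖y‖ ^ q)
    (Metric.ball (0 : E) 1)ᶜ hR
  rw [← Set.image_smul, Set.image_compl_eq (MulAction.bijective₀ hR.ne'), Set.image_smul,
    smul_ball hR.ne', smul_zero, Real.norm_of_nonneg hR.le,
    mul_one, smul_eq_mul] at h
  simp_rw [norm_smul, Real.norm_of_nonneg hR.le, Real.mul_rpow hR.le (norm_nonneg _)] at h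
  rw [integral_const_mul] at h
  rw [Real.rpow_add hR, Real.rpow_natCast, mul_assoc, h, mul_inv_cancel_left₀ (by positivity)]

theorem stmt10 (N : ℕ) (hN : 1 ≤ N) (s σ : ℝ) (hs : s ∈ Set.Ioo (0 : ℝ) 1)
    (hσ : σ ∈ Set.Ioo (0 : ℝ) (2 * s)) :
    ∃ C : ℝ, 0 < C ∧
      ∀ R : ℝ, 2 < R → ∀ x : EuclideanSpace ℝ (Fin N), ‖x‖ < 1 →
        IntegrableOn
          (fun y : EuclideanSpace ℝ (Fin N) =>
            (‖y‖ ^ σ - R ^ σ) * ‖x - y‖ ^ (-((N : ℝ) + 2 * s)))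
          (Metric.ball (0 : EuclideanSpace ℝ (Fin N)) R)ᶜ ∧
        0 ≤ ∫ y in (Metric.ball (0 : EuclideanSpace ℝ (Fin N)) R)ᶜ,
            (‖y‖ ^ σ - R ^ σ) * ‖x - y‖ ^ (-((N : ℝ) + 2 * s)) ∧
        ∫ y in (Metric.ball (0 : EuclideanSpace ℝ (Fin N)) R)ᶜ,
            (‖y‖ ^ σ - R ^ σ) * ‖x - y‖ ^ (-((N : ℝ) + 2 * s))
          ≤ C * R ^ (σ - 2 * s) := by
  obtain ⟨hs0, -⟩ := hs
  obtain ⟨hσ0, hσs⟩ := hσ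
  set p : ℝ := (N : ℝ) + 2 * s with hp
  have hp0 : 0 < p := by positivity
  set K := ∫ y in (Metric.ball (0 : EuclideanSpace ℝ (Fin N)) 1)ᶜ, ‖y‖ ^ (-(p - σ)) with hK
  have hK0 : 0 ≤ K := integral_nonneg fun y => by positivity
  refine ⟨2 ^ p * K + 1, by positivity, fun R hR x hx => ?_⟩
  have hR0 : 0 < R := by linarith
  have hmeas : MeasurableSet (Metric.ball (0 : EuclideanSpace ℝ (Fin N)) R)ᶜ :=
    Metric.isOpen_ball.measurableSet.compl
  have hnonneg : ∀ y ∈ (Metric.ball (0 : EuclideanSpace ℝ (Fin N)) R)ᶜ,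
      0 ≤ (‖y‖ ^ σ - R ^ σ) * ‖x - y‖ ^ (-p) := fun y hy => by
    have hy : R ≤ ‖y‖ := by simpa using hy
    exact mul_nonneg (sub_nonneg.2 (Real.rpow_le_rpow hR0.le hy hσ0.le)) (by positivity)
  have hle : ∀ y ∈ (Metric.ball (0 : EuclideanSpace ℝ (Fin N)) R)ᶜ,
      (‖y‖ ^ σ - R ^ σ) * ‖x - y‖ ^ (-p) ≤ 2 ^ p * ‖y‖ ^ (-(p - σ)) := fun y hy => by
    have hy : R ≤ ‖y‖ := by simpa using hy
    have hy0 : 0 < ‖y‖ := hR0.trans_le hy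
    have hxy : 2⁻¹ * ‖y‖ ≤ ‖x - y‖ := by
      have := norm_sub_norm_le y x
      rw [norm_sub_rev] at this
      linarith
    calc (‖y‖ ^ σ - R ^ σ) * ‖x - y‖ ^ (-p)
        ≤ ‖y‖ ^ σ * (2⁻¹ * ‖y‖) ^ (-p) := by
          refine mul_le_mul (sub_le_self _ (by positivity)) ?_ (by positivity) (by positivity)
          exact Real.rpow_le_rpow_of_nonpos (by positivity) hxy (by linarith)
      _ = 2 ^ p * ‖y‖ ^ (-(p - σ)) := by
          rw [Real.mul_rpow (by norm_num) hy0.le, Real.inv_rpow (by norm_num),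
            Real.rpow_neg (by norm_num), inv_inv, mul_left_comm, ← Real.rpow_add hy0]
          ring_nf
  have hdom : IntegrableOn (fun y : EuclideanSpace ℝ (Fin N) => 2 ^ p * ‖y‖ ^ (-(p - σ)))
      (Metric.ball (0 : EuclideanSpace ℝ (Fin N)) R)ᶜ :=
    ((integrableOn_norm_rpow_compl_ball volume
      (by rw [finrank_euclideanSpace_fin]; linarith)).mono_set
      (Set.compl_subset_compl.2 (Metric.ball_subset_ball (by linarith)))).const_mul _
  have hint : IntegrableOn (fun y : EuclideanSpace ℝ (Fin N) =>
      (‖y‖ ^ σ - R ^ σ) * ‖x - y‖ ^ (-p))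
      (Metric.ball (0 : EuclideanSpace ℝ (Fin N)) R)ᶜ := by
    refine hdom.mono' (Measurable.aestronglyMeasurable (by fun_prop)) ?_
    refine (ae_restrict_mem hmeas).mono fun y hy => ?_
    rw [Real.norm_of_nonneg (hnonneg y hy)]
    exact hle y hy
  refine ⟨hint, setIntegral_nonneg hmeas hnonneg,
    (setIntegral_mono_on hint hdom hmeas hle).trans ?_⟩
  rw [integral_const_mul, setIntegral_norm_rpow_compl_ball volume _ hR0,
    finrank_euclideanSpace_fin, ← hK, show (N : ℝ) + -(p - σ) = σ - 2 * s by rw [hp]; ring]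
  have : 0 ≤ R ^ (σ - 2 * s) := by positivity
  linarith
end

section
/- Let 0 < α < ᾱ, Ā > 0 and ρ ∈ (0,1) satisfy ρ^{ᾱ−α}(4 + 3Ā) ≤ 1/100. Let w : ℝ^N → ℝ satisfy |w(x)| ≤ 1 + |x|^{1+ᾱ} for all x ∈ ℝ^N, and let h : B₁ → ℝ, c₀ ∈ ℝ, p ∈ ℝ^N satisfy sup_{B₁} |w − h| ≤ ρ^{1+α}/2, |c₀| ≤ Ā, |p| ≤ Ā, and |h(x) − c₀ − p·x| ≤ Ā |x|^{1+ᾱ} for all x ∈ B₁. Then the rescaled function w̃(x) := ρ^{−(1+α)} ( w(ρx) − c₀ − ρ p·x ) satisfies |w̃(x)| ≤ 1 + |x|^{1+ᾱ} for all x ∈ ℝ^N. -/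
open scoped RealInnerProductSpace

theorem stmt14 (N : ℕ) (hN : 1 ≤ N) (α α' A ρ : ℝ)
    (hα : 0 < α) (hαα' : α < α') (hA : 0 < A) (hρ : ρ ∈ Set.Ioo (0 : ℝ) 1)
    (hsmall : ρ ^ (α' - α) * (4 + 3 * A) ≤ 1 / 100)
    (w h : EuclideanSpace ℝ (Fin N) → ℝ) (c₀ : ℝ) (p : EuclideanSpace ℝ (Fin N))
    (hw : ∀ x : EuclideanSpace ℝ (Fin N), |w x| ≤ 1 + ‖x‖ ^ (1 + α'))
    (hwh : ∀ x : EuclideanSpace ℝ (Fin N), ‖x‖ < 1 → |w x - h x| ≤ ρ ^ (1 + α) / 2)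
    (hc₀ : |c₀| ≤ A) (hp : ‖p‖ ≤ A)
    (hh : ∀ x : EuclideanSpace ℝ (Fin N), ‖x‖ < 1 →
      |h x - c₀ - ⟪p, x⟫| ≤ A * ‖x‖ ^ (1 + α')) :
    ∀ x : EuclideanSpace ℝ (Fin N),
      |ρ ^ (-(1 + α)) * (w (ρ • x) - c₀ - ρ * ⟪p, x⟫)| ≤ 1 + ‖x‖ ^ (1 + α') := by
  obtain ⟨hρ0, -⟩ := hρ
  intro x
  have hnorm : ‖ρ • x‖ = ρ * ‖x‖ := by rw [norm_smul, Real.norm_of_nonneg hρ0.le]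
  have hinner : ⟪p, ρ • x⟫ = ρ * ⟪p, x⟫ := real_inner_smul_right p x ρ
  have hK : 0 < ρ ^ (-(1 + α)) := Real.rpow_pos_of_pos hρ0 _
  have hK1 : ρ ^ (-(1 + α)) * ρ ^ (1 + α) = 1 := by
    rw [← Real.rpow_add hρ0, neg_add_cancel, Real.rpow_zero]
  have hKs : ρ ^ (-(1 + α)) * ‖ρ • x‖ ^ (1 + α') = ρ ^ (α' - α) * ‖x‖ ^ (1 + α') := by
    rw [hnorm, Real.mul_rpow hρ0.le (norm_nonneg x), ← mul_assoc, ← Real.rpow_add hρ0]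
    ring_nf
  have hT : 0 ≤ ‖x‖ ^ (1 + α') := Real.rpow_nonneg (norm_nonneg x) _
  have hq : 0 < ρ ^ (α' - α) := Real.rpow_pos_of_pos hρ0 _
  have hqA : 0 < ρ ^ (α' - α) * A := mul_pos hq hA
  rw [abs_mul, abs_of_pos hK, ← hinner]
  rcases lt_or_ge ‖ρ • x‖ 1 with hs | hs
  · have hb : |w (ρ • x) - c₀ - ⟪p, ρ • x⟫|
        ≤ ρ ^ (1 + α) / 2 + A * ‖ρ • x‖ ^ (1 + α') := by
      calc |w (ρ • x) - c₀ - ⟪p, ρ • x⟫|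
          = |(w (ρ • x) - h (ρ • x)) + (h (ρ • x) - c₀ - ⟪p, ρ • x⟫)| := by ring_nf
        _ ≤ _ := (abs_add_le _ _).trans (add_le_add (hwh _ hs) (hh _ hs))
    calc _ ≤ ρ ^ (-(1 + α)) * (ρ ^ (1 + α) / 2 + A * ‖ρ • x‖ ^ (1 + α')) := by gcongr
      _ = 1 / 2 + ρ ^ (α' - α) * A * ‖x‖ ^ (1 + α') := by linear_combination hK1 / 2 + A * hKs
      _ ≤ 1 + 1 * ‖x‖ ^ (1 + α') := by
        gcongr
        · norm_num
        · linarith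
      _ = _ := by ring
  · have hs1 : ‖ρ • x‖ ≤ ‖ρ • x‖ ^ (1 + α') := Real.self_le_rpow_of_one_le hs (by linarith)
    have hpx : |⟪p, ρ • x⟫| ≤ A * ‖ρ • x‖ :=
      (abs_real_inner_le_norm _ _).trans (by gcongr)
    have hb : |w (ρ • x) - c₀ - ⟪p, ρ • x⟫| ≤ (2 + 2 * A) * ‖ρ • x‖ ^ (1 + α') := by
      have h1 := abs_sub (w (ρ • x) - c₀) ⟪p, ρ • x⟫
      have h2 := abs_sub (w (ρ • x)) c₀
      have h3 := mul_le_mul_of_nonneg_left hs1 hA.le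
      have h4 := mul_le_mul_of_nonneg_left hs hA.le
      linarith [hw (ρ • x)]
    calc _ ≤ ρ ^ (-(1 + α)) * ((2 + 2 * A) * ‖ρ • x‖ ^ (1 + α')) := by gcongr
      _ = ρ ^ (α' - α) * (2 + 2 * A) * ‖x‖ ^ (1 + α') := by linear_combination (2 + 2 * A) * hKs
      _ ≤ 1 * ‖x‖ ^ (1 + α') := by
        gcongr
        linarith
      _ ≤ _ := by linarith
end

section
/- Let N ≥ 1, s ∈ (0,1) with N > 2s, and σ ∈ (2s − N, 0). There exists a constant C > 0, depending only on N, s and σ, such that for every r > 0, every ε with 0 < ε ≤ r/4, and every x ∈ ℝ^N with r/2 ≤ |x| ≤ r, one has | ∫_{B_ε} (ε^σ − |y|^σ) |x − y|^{−(N+2s)} dy | ≤ C r^{−(N+2s)} ε^{N+σ}. In particular, since N + σ > 2s > 0, for fixed r this quantity tends to 0 as ε → 0. -/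
open MeasureTheory

section NormPower

variable {E : Type*} [NormedAddCommGroup E] [NormedSpace ℝ E] [FiniteDimensional ℝ E]
  [MeasurableSpace E] [BorelSpace E] (μ : Measure E) [μ.IsAddHaarMeasure]

theorem integrableOn_norm_rpow_ball [Nontrivial E] {σ : ℝ}
    (hσ : -(Module.finrank ℝ E : ℝ) < σ) (ε : ℝ) :
    IntegrableOn (fun y : E => ‖y‖ ^ σ) (Metric.ball 0 ε) μ := by
  rw [integrableOn_fun_norm_addHaar μ (f := fun t : ℝ => t ^ σ)]
  rcases le_or_gt ε 0 with hε | hε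
  · simp [Set.Ioo_eq_empty (not_lt.mpr hε)]
  have hpow : IntegrableOn (fun t : ℝ => t ^ ((Module.finrank ℝ E : ℝ) - 1 + σ))
      (Set.Ioo 0 ε) := by
    rw [intervalIntegral.integrableOn_Ioo_rpow_iff hε]
    linarith
  refine hpow.congr_fun (fun t ht => ?_) measurableSet_Ioo
  have hdim : 1 ≤ Module.finrank ℝ E := Module.finrank_pos
  simp only [smul_eq_mul]
  rw [Real.rpow_add ht.1, ← Real.rpow_natCast, Nat.cast_sub hdim, Nat.cast_one]

theorem setIntegral_ball_rpow_add_norm_rpow (σ : ℝ) {ε : ℝ} (hε : 0 < ε) :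
    ∫ y in Metric.ball (0 : E) ε, (ε ^ σ + ‖y‖ ^ σ) ∂μ =
      ε ^ ((Module.finrank ℝ E : ℝ) + σ) *
        ∫ y in Metric.ball (0 : E) 1, (1 + ‖y‖ ^ σ) ∂μ := by
  have hscale := Measure.setIntegral_comp_smul_of_pos μ
    (fun y : E => ε ^ σ + ‖y‖ ^ σ) (Metric.ball 0 1) hε
  rw [smul_unitBall_of_pos hε] at hscale
  have hfactor : ∀ y : E, ε ^ σ + ‖ε • y‖ ^ σ = ε ^ σ * (1 + ‖y‖ ^ σ) := fun y => by
    rw [norm_smul, Real.norm_of_nonneg hε.le, Real.mul_rpow hε.le (norm_nonneg y)]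
    ring
  simp only [hfactor, integral_const_mul, smul_eq_mul] at hscale
  rw [Real.rpow_add hε, Real.rpow_natCast, mul_assoc, hscale, mul_inv_cancel_left₀ (by positivity)]

end NormPower

theorem norm_sub_rpow_neg_le {E : Type*} [SeminormedAddCommGroup E] {x y : E} {r p : ℝ}
    (hr : 0 < r) (hp : 0 ≤ p) (hx : r / 2 ≤ ‖x‖) (hy : ‖y‖ ≤ r / 4) :
    ‖x - y‖ ^ (-p) ≤ 4 ^ p * r ^ (-p) := by
  have hdist : r / 4 ≤ ‖x - y‖ := by linarith [norm_sub_norm_le x y]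
  calc ‖x - y‖ ^ (-p) ≤ (r / 4) ^ (-p) :=
        Real.rpow_le_rpow_of_nonpos (by positivity) hdist (by linarith)
    _ = 4 ^ p * r ^ (-p) := by
        rw [Real.div_rpow hr.le (by norm_num), Real.rpow_neg (by norm_num : (0 : ℝ) ≤ 4),
          div_inv_eq_mul, mul_comm]

theorem stmt16 (N : ℕ) (hN : 1 ≤ N) (s σ : ℝ) (hs : s ∈ Set.Ioo (0 : ℝ) 1)
    (hNs : 2 * s < (N : ℝ)) (hσ : σ ∈ Set.Ioo (2 * s - (N : ℝ)) 0) :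
    ∃ C : ℝ, 0 < C ∧
      ∀ r : ℝ, 0 < r → ∀ ε : ℝ, 0 < ε → ε ≤ r / 4 →
        ∀ x : EuclideanSpace ℝ (Fin N), r / 2 ≤ ‖x‖ → ‖x‖ ≤ r →
          IntegrableOn
            (fun y : EuclideanSpace ℝ (Fin N) =>
              (ε ^ σ - ‖y‖ ^ σ) * ‖x - y‖ ^ (-((N : ℝ) + 2 * s)))
            (Metric.ball (0 : EuclideanSpace ℝ (Fin N)) ε) ∧
          |∫ y in Metric.ball (0 : EuclideanSpace ℝ (Fin N)) ε,
              (ε ^ σ - ‖y‖ ^ σ) * ‖x - y‖ ^ (-((N : ℝ) + 2 * s))| ≤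
            C * r ^ (-((N : ℝ) + 2 * s)) * ε ^ ((N : ℝ) + σ) := by
  have : Nonempty (Fin N) := ⟨⟨0, hN⟩⟩
  set K := ∫ y in Metric.ball (0 : EuclideanSpace ℝ (Fin N)) 1, (1 + ‖y‖ ^ σ) with hK
  have hK_nonneg : 0 ≤ K := integral_nonneg fun y => by positivity
  have hp : 0 ≤ (N : ℝ) + 2 * s := by linarith [hs.1, (Nat.cast_nonneg N : (0 : ℝ) ≤ N)]
  set p := (N : ℝ) + 2 * s
  refine ⟨4 ^ p * (K + 1), by positivity, fun r hr ε hε hεr x hx _ => ?_⟩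
  have hdom : IntegrableOn (fun y : EuclideanSpace ℝ (Fin N) =>
      4 ^ p * r ^ (-p) * (ε ^ σ + ‖y‖ ^ σ)) (Metric.ball 0 ε) := by
    refine Integrable.const_mul (Integrable.add ?_ ?_) _
    · exact integrableOn_const measure_ball_lt_top.ne
    · refine integrableOn_norm_rpow_ball volume ?_ ε
      rw [finrank_euclideanSpace_fin]
      linarith [hs.1, hσ.1]
  have hbound : ∀ᵐ y ∂volume.restrict (Metric.ball (0 : EuclideanSpace ℝ (Fin N)) ε),
      ‖(ε ^ σ - ‖y‖ ^ σ) * ‖x - y‖ ^ (-p)‖ ≤ 4 ^ p * r ^ (-p) * (ε ^ σ + ‖y‖ ^ σ) := by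
    filter_upwards [ae_restrict_mem measurableSet_ball] with y hy
    have hy' : ‖y‖ ≤ r / 4 := (mem_ball_zero_iff.mp hy).le.trans hεr
    have hε_pow : 0 ≤ ε ^ σ := by positivity
    have hy_pow : 0 ≤ ‖y‖ ^ σ := by positivity
    rw [norm_mul, Real.norm_of_nonneg (by positivity : 0 ≤ ‖x - y‖ ^ (-p)), mul_comm]
    refine mul_le_mul (norm_sub_rpow_neg_le hr hp hx hy') ?_ (norm_nonneg _) (by positivity)
    rw [Real.norm_eq_abs, abs_le]
    constructor <;> linarith
  refine ⟨hdom.mono' (Measurable.aestronglyMeasurable (by fun_prop)) hbound, ?_⟩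
  have hint := norm_integral_le_of_norm_le hdom hbound
  rw [integral_const_mul, setIntegral_ball_rpow_add_norm_rpow volume σ hε,
    finrank_euclideanSpace_fin, ← hK] at hint
  calc _ ≤ 4 ^ p * r ^ (-p) * (ε ^ ((N : ℝ) + σ) * K) := hint
    _ ≤ 4 ^ p * r ^ (-p) * (ε ^ ((N : ℝ) + σ) * (K + 1)) := by gcongr; linarith
    _ = 4 ^ p * (K + 1) * r ^ (-p) * ε ^ ((N : ℝ) + σ) := by ring
end
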